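/- Let L : ℝ × U × E → ℝ be a regular time dependent Lagrangian of class C² with canonical semispray coefficient Z₂, and let Y₂ : ℝ × U × E → E (the vertical part of an external force field). If c : (a,b) → U is a C² curve satisfying c''(s) = Z₂(s, c(s), c'(s)) + Y₂(s, c(s), c'(s)) for all s, then c satisfies the Lagrange equations with external force: for every z ∈ E, the function s ↦ ∂₃L(s, c(s), c'(s))[z] is differentiable with (d/ds) ∂₃L(s, c(s), c'(s))[z] = ∂₂L(s, c(s), c'(s))[z] + ∂₃²L(s, c(s), c'(s))[z, Y₂(s, c(s), c'(s))]. -/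

import Mathlib

open Set

variable {E : Type*} [NormedAddCommGroup E] [NormedSpace ℝ E]

/-- `∂₁L(t,x,y)`, partial derivative of the Lagrangian in the time variable. -/
noncomputable def d1L (L : ℝ → E → E → ℝ) (t : ℝ) (x y : E) : ℝ :=
  deriv (fun t' => L t' x y) t

/-- `∂₂L(t,x,y)`, partial Fréchet derivative of the Lagrangian in the base variable. -/
noncomputable def d2L (L : ℝ → E → E → ℝ) (t : ℝ) (x y : E) : E →L[ℝ] ℝ :=
  fderiv ℝ (fun x' => L t x' y) x

/-- `∂₃L(t,x,y)`, partial Fréchet derivative of the Lagrangian in the fiber variable. -/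
noncomputable def d3L (L : ℝ → E → E → ℝ) (t : ℝ) (x y : E) : E →L[ℝ] ℝ :=
  fderiv ℝ (fun y' => L t x y') y

/-- `d13L L t x y z` is `∂₁∂₃L(t,x,y)[z]`, the time derivative of `∂₃L(·,x,y)z`. -/
noncomputable def d13L (L : ℝ → E → E → ℝ) (t : ℝ) (x y : E) : E →L[ℝ] ℝ :=
  deriv (fun t' => d3L L t' x y) t

/-- `d23L L t x y a z` is `∂₂∂₃L(t,x,y)[z,a]`, the derivative in base direction `a` of
`∂₃L(t,·,y)z`. -/
noncomputable def d23L (L : ℝ → E → E → ℝ) (t : ℝ) (x y : E) : E →L[ℝ] E →L[ℝ] ℝ :=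
  fderiv ℝ (fun x' => d3L L t x' y) x

/-- `d33L L t x y w z` is `∂₃²L(t,x,y)[z,w]`, the derivative in fiber direction `w` of
`∂₃L(t,x,·)z`. -/
noncomputable def d33L (L : ℝ → E → E → ℝ) (t : ℝ) (x y : E) : E →L[ℝ] E →L[ℝ] ℝ :=
  fderiv ℝ (fun y' => d3L L t x y') y

/-- A time dependent Lagrangian `L` is regular on `U` if it is C² and at every point of
`ℝ × U × E` the map `X ↦ ∂₃²L(v)[·, X]` is a continuous linear isomorphism `E → E*`. -/
def RegularLagrangian (L : ℝ → E → E → ℝ) (U : Set E) : Prop :=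
  ContDiffOn ℝ 2 (fun p : ℝ × E × E => L p.1 p.2.1 p.2.2) (univ ×ˢ U ×ˢ univ) ∧
  ∀ t : ℝ, ∀ x ∈ U, ∀ y : E,
    ∃ e : E ≃L[ℝ] (E →L[ℝ] ℝ), ∀ X : E, e X = d33L L t x y X

/-- The fiber derivative of a C² Lagrangian is differentiable in all its variables jointly. -/
theorem differentiableAt_d3L {E : Type*} [NormedAddCommGroup E] [NormedSpace ℝ E]
    {U : Set E} (hU : IsOpen U) {L : ℝ → E → E → ℝ}
    (hL : ContDiffOn ℝ 2 (fun p : ℝ × E × E => L p.1 p.2.1 p.2.2) (univ ×ˢ U ×ˢ univ))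
    (t : ℝ) {x : E} (hx : x ∈ U) (y : E) :
    DifferentiableAt ℝ (fun p : ℝ × E × E => d3L L p.1 p.2.1 p.2.2) (t, x, y) := by
  set F : ℝ × E × E → ℝ := fun p => L p.1 p.2.1 p.2.2
  have hO : IsOpen ((univ : Set ℝ) ×ˢ U ×ˢ (univ : Set E)) :=
    isOpen_univ.prod (hU.prod isOpen_univ)
  have hmem : (t, x, y) ∈ (univ : Set ℝ) ×ˢ U ×ˢ (univ : Set E) := by simp [hx]
  let J : E →L[ℝ] ℝ × E × E :=
    (ContinuousLinearMap.inr ℝ ℝ (E × E)).comp (ContinuousLinearMap.inr ℝ E E)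
  have hF' : DifferentiableAt ℝ (fderiv ℝ F) (t, x, y) :=
    ((hL.fderiv_of_isOpen hO (m := 1) (by norm_num)).contDiffAt
      (hO.mem_nhds hmem)).differentiableAt (by norm_num)
  refine (hF'.clm_comp (differentiableAt_const J)).congr_of_eventuallyEq ?_
  filter_upwards [hO.mem_nhds hmem] with q hq
  have hFq : HasFDerivAt F (fderiv ℝ F q) (q.1, q.2.1, q.2.2) :=
    ((hL.contDiffAt (hO.mem_nhds hq)).differentiableAt (by norm_num)).hasFDerivAt
  have hJ : HasFDerivAt (fun y' : E => (q.1, q.2.1, y')) J q.2.2 :=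
    (hasFDerivAt_prodMk_right q.1 q.2).comp q.2.2 (hasFDerivAt_prodMk_right q.2.1 q.2.2)
  exact (hFq.comp q.2.2 hJ).fderiv

/-- Chain rule for the fiber derivative of a C² Lagrangian along a curve in `ℝ × U × E`
parametrized by time. -/
theorem hasDerivAt_d3L_comp {E : Type*} [NormedAddCommGroup E] [NormedSpace ℝ E]
    {U : Set E} (hU : IsOpen U) {L : ℝ → E → E → ℝ}
    (hL : ContDiffOn ℝ 2 (fun p : ℝ × E × E => L p.1 p.2.1 p.2.2) (univ ×ˢ U ×ˢ univ))
    {x y : ℝ → E} {x' y' : E} {s : ℝ} (hxU : x s ∈ U)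
    (hx : HasDerivAt x x' s) (hy : HasDerivAt y y' s) :
    HasDerivAt (fun r => d3L L r (x r) (y r))
      (d13L L s (x s) (y s) + d23L L s (x s) (y s) x' + d33L L s (x s) (y s) y') s := by
  obtain ⟨D, hD⟩ := differentiableAt_d3L hU hL s hxU (y s)
  have h1 : d13L L s (x s) (y s) = D (1, 0, 0) := by
    have h := hD.comp_hasDerivAt s ((hasDerivAt_id s).prodMk (hasDerivAt_const s (x s, y s)))
    exact h.deriv
  have h2 : d23L L s (x s) (y s) x' = D (0, x', 0) := by
    have hι : HasFDerivAt (fun x₀ : E => (s, x₀, y s))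
        ((ContinuousLinearMap.inr ℝ ℝ (E × E)).comp (ContinuousLinearMap.inl ℝ E E)) (x s) :=
      (hasFDerivAt_prodMk_right s (x s, y s)).comp (x s) (hasFDerivAt_prodMk_left (x s) (y s))
    have h := hD.comp (x s) hι
    exact congrArg (fun A : E →L[ℝ] E →L[ℝ] ℝ => A x') h.fderiv
  have h3 : d33L L s (x s) (y s) y' = D (0, 0, y') := by
    have hι : HasFDerivAt (fun y₀ : E => (s, x s, y₀))
        ((ContinuousLinearMap.inr ℝ ℝ (E × E)).comp (ContinuousLinearMap.inr ℝ E E)) (y s) :=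
      (hasFDerivAt_prodMk_right s (x s, y s)).comp (y s) (hasFDerivAt_prodMk_right (x s) (y s))
    have h := hD.comp (y s) hι
    exact congrArg (fun A : E →L[ℝ] E →L[ℝ] ℝ => A y') h.fderiv
  rw [h1, h2, h3, ← map_add, ← map_add]
  have h := hD.comp_hasDerivAt s ((hasDerivAt_id s).prodMk (hx.prodMk hy))
  simpa [Function.comp_def] using h

/-- Geodesics of the semispray `Z₂ + Y₂` (Lagrangian semispray plus a
vertical force field) satisfy the Lagrange equations with external force. -/
theorem forced_geodesics_satisfy_lagrange_equations
    {E : Type*} [NormedAddCommGroup E] [NormedSpace ℝ E] [CompleteSpace E]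
    (U : Set E) (hU : IsOpen U) (L : ℝ → E → E → ℝ)
    (hreg : RegularLagrangian L U)
    (Z₂ : ℝ → E → E → E)
    (hZ₂ : ∀ t : ℝ, ∀ x ∈ U, ∀ y z : E,
      d33L L t x y (Z₂ t x y) z
        = d2L L t x y z - d13L L t x y z - d23L L t x y y z)
    (Y₂ : ℝ → E → E → E)
    (a b : ℝ) (c : ℝ → E)
    (hcU : MapsTo c (Ioo a b) U) (hc : ContDiffOn ℝ 2 c (Ioo a b))
    (hgeo : ∀ s ∈ Ioo a b,
      deriv (deriv c) s = Z₂ s (c s) (deriv c s) + Y₂ s (c s) (deriv c s)) :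
    ∀ s ∈ Ioo a b, ∀ z : E,
      HasDerivAt (fun r => d3L L r (c r) (deriv c r) z)
        (d2L L s (c s) (deriv c s) z
          + d33L L s (c s) (deriv c s) (Y₂ s (c s) (deriv c s)) z) s := by
  intro s hs z
  have hnhds : Ioo a b ∈ nhds s := isOpen_Ioo.mem_nhds hs
  have hc₁ : HasDerivAt c (deriv c s) s :=
    ((hc.contDiffAt hnhds).differentiableAt (by norm_num)).hasDerivAt
  have hc₂ : HasDerivAt (deriv c) (deriv (deriv c) s) s :=
    (((hc.deriv_of_isOpen isOpen_Ioo (m := 1) (by norm_num)).contDiffAt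
      hnhds).differentiableAt (by norm_num)).hasDerivAt
  have h := (hasDerivAt_d3L_comp hU hreg.1 (hcU hs) hc₁ hc₂).clm_apply (hasDerivAt_const s z)
  refine h.congr_deriv ?_
  have hZ := hZ₂ s (c s) (hcU hs) (deriv c s) z
  rw [hgeo s hs]
  simp only [map_add, map_zero, add_apply, add_zero, hZ]
  ring
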